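/- Let 𝔽 be a field equipped with a field automorphism Φ, let 𝕂 ⊆ 𝔽 be a subfield stable under Φ, and let C := {c ∈ 𝔽 : Φ(c) = c} be the fixed field of Φ. Assume C is algebraically closed, C ⊆ 𝕂, and Φ is non-periodic on 𝕂 (there exists x ∈ 𝕂 such that Φⁿ(x) ≠ x for every nonzero integer n). Let z₁, z₂ ∈ 𝔽 be nonzero elements such that Φ(z₁) = a₁·z₁ and Φ(z₂) = a₂·z₂ for some nonzero a₁, a₂ ∈ 𝕂. If z₁ and z₂ are algebraically dependent over 𝕂, then there exist integers (α₁, α₂) ≠ (0, 0) such that z₁^{α₁}·z₂^{α₂} ∈ 𝕂. -/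

import Mathlib

/-- The fixed subfield of a field automorphism. -/
def fixedSubfield {F : Type*} [Field F] (Φ : F ≃+* F) : Subfield F where
  carrier := {c | Φ c = c}
  mul_mem' := by intro a b ha hb; simp_all [Set.mem_setOf_eq]
  one_mem' := by simp
  add_mem' := by intro a b ha hb; simp_all [Set.mem_setOf_eq]
  zero_mem' := by simp
  neg_mem' := by intro a ha; simp_all [Set.mem_setOf_eq]
  inv_mem' := by intro a ha; simp_all [Set.mem_setOf_eq]

/-- Eigenvectors of `Φ` with eigenvalues in `K` whose pairwise ratios lie outside `K` are linearly
independent over `K`, when `K` contains the fixed field of `Φ`. -/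
theorem coeff_eq_zero_of_sum_eigenvectors_eq_zero {F ι : Type*} [Field F] [DecidableEq ι]
    (Φ : F ≃+* F) (K : Subfield F) (hstab : ∀ a ∈ K, Φ a ∈ K) (hCK : fixedSubfield Φ ≤ K)
    (v b : ι → F) (hv : ∀ i, v i ≠ 0) (hb : ∀ i, b i ∈ K) (hΦ : ∀ i, Φ (v i) = b i * v i)
    (hratio : ∀ i j, i ≠ j → v j / v i ∉ K) (s : Finset ι) :
    ∀ c : ι → F, (∀ i, c i ∈ K) → ∑ i ∈ s, c i * v i = 0 → ∀ i ∈ s, c i = 0 := by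
  induction s using Finset.induction_on with
  | empty => simp
  | insert i s his ih =>
    intro c hc hsum
    rw [Finset.sum_insert his] at hsum
    have hci : c i = 0 := by
      by_contra hci
      have hnorm : v i + ∑ j ∈ s, c j / c i * v j = 0 := by
        have h : c i * (v i + ∑ j ∈ s, c j / c i * v j) = 0 := by
          rw [mul_add, Finset.mul_sum, ← hsum]
          congr 1
          refine Finset.sum_congr rfl fun j _ => ?_
          field_simp
        exact (mul_eq_zero.mp h).resolve_left hci
      have himage : b i * v i + ∑ j ∈ s, Φ (c j / c i) * b j * v j = 0 := by
        have h := congrArg Φ hnorm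
        rw [map_add, map_sum, map_zero, hΦ] at h
        simpa only [map_mul, hΦ, mul_assoc] using h
      have hdiff : ∑ j ∈ s, (Φ (c j / c i) * b j - b i * (c j / c i)) * v j = 0 := by
        simp only [sub_mul, Finset.sum_sub_distrib, mul_assoc (b i), ← Finset.mul_sum]
        linear_combination himage - b i * hnorm
      have hd : ∀ j, c j / c i ∈ K := fun j => K.div_mem (hc j) (hc i)
      have heig := ih _ (fun j => K.sub_mem (K.mul_mem (hstab _ (hd j)) (hb j))
        (K.mul_mem (hb i) (hd j))) hdiff
      have hbi : b i ≠ 0 := by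
        intro h
        have h' := hΦ i
        rw [h, zero_mul, map_eq_zero] at h'
        exact hv i h'
      have hzero : ∀ j ∈ s, c j / c i = 0 := by
        intro j hj
        by_contra hdj
        have hfix : c j / c i * v j / v i ∈ fixedSubfield Φ := by
          change Φ (c j / c i * v j / v i) = c j / c i * v j / v i
          rw [map_div₀, map_mul, hΦ, hΦ, ← mul_assoc, sub_eq_zero.mp (heig j hj), mul_assoc,
            mul_div_mul_left _ _ hbi]
        refine hratio i j (fun h => his (h ▸ hj)) ?_
        have h := K.div_mem (hCK hfix) (hd j)
        rwa [mul_div_assoc, mul_div_cancel_left₀ _ hdj] at h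
      rw [Finset.sum_eq_zero fun j hj => by rw [hzero j hj, zero_mul], add_zero] at hnorm
      exact hv i hnorm
    rw [hci, zero_mul, zero_add] at hsum
    intro j hj
    rcases Finset.mem_insert.mp hj with rfl | hj
    · exact hci
    · exact ih c hc hsum j hj


/-- **Example (diagonal systems: Galoisian monomial relations).**
Let `𝔽` be a field with an automorphism `Φ`, `𝕂 ⊆ 𝔽` a subfield stable under `Φ`, and
`C` the fixed field of `Φ`.  Assume `C` is algebraically closed, `C ⊆ 𝕂`, and `Φ` is
non-periodic on `𝕂`.  If `z₁, z₂ ∈ 𝔽` are nonzero with `Φ(zᵢ) = aᵢ zᵢ` for nonzero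
`aᵢ ∈ 𝕂` and `z₁, z₂` are algebraically dependent over `𝕂`, then `z₁^{α₁} z₂^{α₂} ∈ 𝕂`
for some integers `(α₁, α₂) ≠ (0, 0)`. -/
theorem diagonal_system_monomial_relation {F : Type*} [Field F]
    (Φ : F ≃+* F) (K : Subfield F)
    (hstab : ∀ a ∈ K, Φ a ∈ K)
    (halgcl : IsAlgClosed ↥(fixedSubfield Φ))
    (hCK : fixedSubfield Φ ≤ K)
    (hnp : ∃ x ∈ K, ∀ n : ℤ, n ≠ 0 → (Φ ^ n) x ≠ x)
    (z₁ z₂ : F) (hz₁ : z₁ ≠ 0) (hz₂ : z₂ ≠ 0)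
    (a₁ a₂ : F) (ha₁K : a₁ ∈ K) (ha₂K : a₂ ∈ K) (ha₁ : a₁ ≠ 0) (ha₂ : a₂ ≠ 0)
    (hΦ₁ : Φ z₁ = a₁ * z₁) (hΦ₂ : Φ z₂ = a₂ * z₂)
    (hdep : ∃ P : MvPolynomial (Fin 2) ↥K, P ≠ 0 ∧ MvPolynomial.aeval ![z₁, z₂] P = 0) :
    ∃ α₁ α₂ : ℤ, (α₁, α₂) ≠ (0, 0) ∧ z₁ ^ α₁ * z₂ ^ α₂ ∈ K := by
  obtain ⟨P, hP, hPz⟩ := hdep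
  by_contra! hno
  have hratio : ∀ m n : Fin 2 →₀ ℕ, m ≠ n →
      z₁ ^ n 0 * z₂ ^ n 1 / (z₁ ^ m 0 * z₂ ^ m 1) ∉ K := by
    intro m n hmn
    have h := hno ((n 0 : ℤ) - m 0) ((n 1 : ℤ) - m 1) (by
      intro h
      rw [Prod.mk.injEq] at h
      refine hmn (Finsupp.ext fun i => ?_)
      fin_cases i
      · exact (Int.natCast_inj.mp (sub_eq_zero.mp h.1)).symm
      · exact (Int.natCast_inj.mp (sub_eq_zero.mp h.2)).symm)
    rwa [zpow_sub₀ hz₁, zpow_sub₀ hz₂, zpow_natCast, zpow_natCast, zpow_natCast, zpow_natCast,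
      div_mul_div_comm] at h
  have hsum : ∑ m ∈ P.support, ((P.coeff m : K) : F) * (z₁ ^ m 0 * z₂ ^ m 1) = 0 := by
    rw [MvPolynomial.aeval_def, MvPolynomial.eval₂_eq'] at hPz
    simp only [Fin.prod_univ_two] at hPz
    exact hPz
  obtain ⟨m, hm⟩ := MvPolynomial.support_nonempty.mpr hP
  refine MvPolynomial.mem_support_iff.mp hm (Subtype.ext ?_)
  refine coeff_eq_zero_of_sum_eigenvectors_eq_zero Φ K hstab hCK
    (fun m : Fin 2 →₀ ℕ => z₁ ^ m 0 * z₂ ^ m 1) (fun m => a₁ ^ m 0 * a₂ ^ m 1)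
    (fun m => mul_ne_zero (pow_ne_zero _ hz₁) (pow_ne_zero _ hz₂))
    (fun m => K.mul_mem (K.pow_mem ha₁K _) (K.pow_mem ha₂K _)) (fun m => ?_) hratio P.support
    (fun m => ((P.coeff m : K) : F)) (fun m => (P.coeff m).2) hsum m hm
  simp only [map_mul, map_pow, hΦ₁, hΦ₂]
  ring
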